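/- arXiv:0908.3784 — 3 statements merged into one kernel-verified Lean document; each statement's English description precedes it below -/
import Mathlib

section
/- Let 𝒜 = (I, (A_a)_{a∈Σ}, F) be a right minimal and uniformly convergent WFA, and let ℬ = (I, (A_a)_{a∈Σ}, F') be obtained from 𝒜 by replacing the final distribution F with an arbitrary column vector F'. Then ℬ is uniformly convergent and there exists a constant c ∈ ℝ such that f_ℬ(w) = c · f_𝒜(w) for all w ∈ Σ^ω. -/
open Filter Topology Matrix

/-- The prefix of length `k` of an infinite word `w`. -/
def pref {A : Type*} (w : ℕ → A) (k : ℕ) : List A := (List.range k).map w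

/-- The product `A_{v₁} ⋯ A_{v_k}` of matrices along a finite word `v`. -/
def wordProd {A : Type*} {n : ℕ} (M : A → Matrix (Fin n) (Fin n) ℝ) (v : List A) :
    Matrix (Fin n) (Fin n) ℝ := (v.map M).prod

/-- The word function of the WFA `(I, M, F)`: `v ↦ I A_v F`. -/
def wfaWord {A : Type*} {n : ℕ} (I : Fin n → ℝ) (M : A → Matrix (Fin n) (Fin n) ℝ)
    (F : Fin n → ℝ) (v : List A) : ℝ := I ⬝ᵥ (wordProd M v) *ᵥ F

/-- The WFA with `n` states is left minimal: the row vectors `I A_u` span `ℝⁿ`. -/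
def LeftMinimal {A : Type*} {n : ℕ} (I : Fin n → ℝ)
    (M : A → Matrix (Fin n) (Fin n) ℝ) : Prop :=
  Submodule.span ℝ {x : Fin n → ℝ | ∃ u : List A, x = I ᵥ* (wordProd M u)} = ⊤

/-- The WFA with `n` states is right minimal: the column vectors `A_u F` span `ℝⁿ`. -/
def RightMinimal {A : Type*} {n : ℕ} (M : A → Matrix (Fin n) (Fin n) ℝ)
    (F : Fin n → ℝ) : Prop :=
  Submodule.span ℝ {x : Fin n → ℝ | ∃ u : List A, x = (wordProd M u) *ᵥ F} = ⊤

/-- A word function `F : Σ* → ℝ` is uniformly convergent with ω-function `f`. -/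
def UnifConv {A : Type*} (F : List A → ℝ) (f : (ℕ → A) → ℝ) : Prop :=
  (∀ w : ℕ → A, Tendsto (fun k => F (pref w k)) atTop (𝓝 (f w))) ∧
  ∀ ε > (0 : ℝ), ∃ k₀ : ℕ, ∀ w : ℕ → A, ∀ k > k₀, |F (pref w k) - f w| < ε

/-- The infinite word that agrees with `w` on the first `k` letters, continues with the finite
word `u`, and then repeats the letter `a`. -/
def spliceWord {A : Type*} (w : ℕ → A) (k : ℕ) (u : List A) (a : A) : ℕ → A :=
  fun i => if i < k then w i else u.getD (i - k) a

theorem pref_spliceWord {A : Type*} (w : ℕ → A) (k : ℕ) (u : List A) (a : A) :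
    pref (spliceWord w k u a) k = pref w k := by
  simp only [pref, List.map_inj_left, List.mem_range]
  intro i hi
  simp [spliceWord, hi]

theorem pref_spliceWord_add_length {A : Type*} (w : ℕ → A) (k : ℕ) (u : List A) (a : A) :
    pref (spliceWord w k u a) (k + u.length) = pref w k ++ u := by
  refine List.ext_getElem (by simp [pref]) fun i h₁ h₂ => ?_
  have hi : i < k + u.length := by simpa [pref] using h₁
  by_cases hk : i < k
  · simp [pref, spliceWord, hk]
  · have hu : i - k < u.length := by omega
    simp [pref, spliceWord, hk, List.getElem_append, hu]

theorem wordProd_append {A : Type*} {n : ℕ} (M : A → Matrix (Fin n) (Fin n) ℝ) (v u : List A) :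
    wordProd M (v ++ u) = wordProd M v * wordProd M u := by
  simp [wordProd]

theorem wfaWord_wordProd_mulVec {A : Type*} {n : ℕ} (I : Fin n → ℝ)
    (M : A → Matrix (Fin n) (Fin n) ℝ) (F : Fin n → ℝ) (u v : List A) :
    wfaWord I M (wordProd M u *ᵥ F) v = wfaWord I M F (v ++ u) := by
  simp [wfaWord, wordProd_append, Matrix.mulVec_mulVec]

theorem unifConv_iff_tendstoUniformly {A : Type*} {F : List A → ℝ} {f : (ℕ → A) → ℝ} :
    UnifConv F f ↔ TendstoUniformly (fun k w => F (pref w k)) f atTop := by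
  constructor
  · rintro ⟨-, h⟩
    rw [Metric.tendstoUniformly_iff]
    intro ε hε
    obtain ⟨k₀, hk₀⟩ := h ε hε
    filter_upwards [eventually_gt_atTop k₀] with k hk w
    rw [dist_comm, Real.dist_eq]
    exact hk₀ w k hk
  · intro h
    refine ⟨h.tendsto_at, fun ε hε => ?_⟩
    obtain ⟨k₀, hk₀⟩ := eventually_atTop.1 (Metric.tendstoUniformly_iff.1 h ε hε)
    refine ⟨k₀, fun w k hk => ?_⟩
    rw [← Real.dist_eq, dist_comm]
    exact hk₀ k hk.le w

/-- Appending a fixed word `u` to the prefixes does not change the limit of a uniformly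
convergent word function. -/
theorem UnifConv.append {A : Type*} [Nonempty A] {F : List A → ℝ} {f : (ℕ → A) → ℝ}
    (h : UnifConv F f) (u : List A) : UnifConv (fun v => F (v ++ u)) f := by
  obtain ⟨a⟩ := ‹Nonempty A›
  rw [unifConv_iff_tendstoUniformly, Metric.tendstoUniformly_iff]
  intro ε hε
  obtain ⟨k₀, hk₀⟩ := h.2 (ε / 3) (by positivity)
  filter_upwards [eventually_gt_atTop k₀] with k hk w
  have h₁ := hk₀ w k hk
  have h₂ := hk₀ (spliceWord w k u a) k hk
  have h₃ := hk₀ (spliceWord w k u a) (k + u.length) (by omega)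
  rw [pref_spliceWord] at h₂
  rw [pref_spliceWord_add_length] at h₃
  rw [Real.dist_eq]
  rw [abs_lt] at *
  constructor <;> linarith

theorem UnifConv.add {A : Type*} {F G : List A → ℝ} {f g : (ℕ → A) → ℝ}
    (hF : UnifConv F f) (hG : UnifConv G g) :
    UnifConv (fun v => F v + G v) (fun w => f w + g w) := by
  rw [unifConv_iff_tendstoUniformly] at *
  exact hF.add hG

theorem UnifConv.const_mul {A : Type*} {F : List A → ℝ} {f : (ℕ → A) → ℝ}
    (hF : UnifConv F f) (r : ℝ) : UnifConv (fun v => r * F v) (fun w => r * f w) := by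
  rw [unifConv_iff_tendstoUniformly] at *
  exact (uniformContinuous_const_smul r).comp_tendstoUniformly hF

/-- Let `𝒜 = (I, (A_a), F)` be a right minimal, uniformly convergent WFA and let
`ℬ = (I, (A_a), F')` be obtained by replacing the final distribution by an arbitrary
column vector `F'`.  Then `ℬ` is uniformly convergent and `f_ℬ = c ⬝ f_𝒜` for some
constant `c ∈ ℝ`. -/
theorem change_final_distribution
    {A : Type*} [Fintype A] [Nonempty A]
    {n : ℕ} (I : Fin n → ℝ) (M : A → Matrix (Fin n) (Fin n) ℝ) (F F' : Fin n → ℝ)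
    (hmin : RightMinimal M F)
    (f : (ℕ → A) → ℝ) (hA : UnifConv (wfaWord I M F) f) :
    ∃ c : ℝ, UnifConv (wfaWord I M F') (fun w => c * f w) := by
  have hF' : F' ∈ Submodule.span ℝ {x : Fin n → ℝ | ∃ u : List A, x = (wordProd M u) *ᵥ F} :=
    hmin ▸ Submodule.mem_top
  induction hF' using Submodule.span_induction with
  | mem x hx =>
    obtain ⟨u, rfl⟩ := hx
    refine ⟨1, ?_⟩
    simpa only [← wfaWord_wordProd_mulVec, one_mul] using hA.append u
  | zero =>
    refine ⟨0, ?_⟩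
    convert hA.const_mul 0 using 2 with v
    simp [wfaWord]
  | add x y _ _ hx hy =>
    obtain ⟨c, hc⟩ := hx
    obtain ⟨d, hd⟩ := hy
    refine ⟨c + d, ?_⟩
    convert hc.add hd using 2 with v w
    · simp only [wfaWord, Matrix.mulVec_add, dotProduct_add]
    · ring
  | smul r x _ hx =>
    obtain ⟨c, hc⟩ := hx
    refine ⟨r * c, ?_⟩
    convert hc.const_mul r using 2 with v w
    · simp only [wfaWord, Matrix.mulVec_smul, dotProduct_smul, smul_eq_mul]
    · ring
end

section
/- Let 𝒜 = (I, (A_a)_{a∈Σ}, F) be a WFA with transition matrix set B = {A_a : a ∈ Σ}. Then: (1) if B is an RCP set, then f_𝒜(w) is defined for every w ∈ Σ^ω; (2) if B is a continuous RCP set, then 𝒜 is uniformly convergent (and hence f_𝒜 is continuous on Σ^ω). -/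
open Filter Topology Matrix

/-- A family of square matrices is an RCP set: all infinite products converge. -/
def IsRCP {A : Type*} {m : ℕ} (M : A → Matrix (Fin m) (Fin m) ℝ) : Prop :=
  ∀ w : ℕ → A, ∃ L : Matrix (Fin m) (Fin m) ℝ,
    Tendsto (fun k => wordProd M (pref w k)) atTop (𝓝 L)

/-- A family of square matrices is a continuous RCP set: all infinite products converge
and the limit depends continuously on the infinite word. -/
def IsContRCP {A : Type*} [TopologicalSpace A] [DiscreteTopology A] {m : ℕ}
    (M : A → Matrix (Fin m) (Fin m) ℝ) : Prop :=
  ∃ Mω : (ℕ → A) → Matrix (Fin m) (Fin m) ℝ, Continuous Mω ∧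
    ∀ w : ℕ → A, Tendsto (fun k => wordProd M (pref w k)) atTop (𝓝 (Mω w))

section PrefixLemmas

variable {A : Type*}

theorem pref_add (w : ℕ → A) (k j : ℕ) :
    pref w (k + j) = pref w k ++ pref (fun i => w (k + i)) j := by
  simp [pref, List.range_add, Function.comp_def]

theorem pref_succ (w : ℕ → A) (k : ℕ) : pref w (k + 1) = pref w k ++ [w k] := by
  simp [pref, List.range_succ]

theorem pref_congr {w w' : ℕ → A} {k : ℕ} (h : ∀ i < k, w i = w' i) :
    pref w k = pref w' k :=
  List.map_congr_left fun i hi => h i (List.mem_range.1 hi)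

/-- The infinite word starting with the first `k` letters of `w` and continuing with `x`. -/
def splice (k : ℕ) (w x : ℕ → A) : ℕ → A := fun i => if i < k then w i else x (i - k)

theorem splice_of_lt {k i : ℕ} (w x : ℕ → A) (h : i < k) : splice k w x i = w i := if_pos h

theorem pref_splice_add (k j : ℕ) (w x : ℕ → A) :
    pref (splice k w x) (k + j) = pref w k ++ pref x j := by
  rw [pref_add, pref_congr fun i hi => splice_of_lt w x hi]
  simp [splice]

theorem tendsto_splice [TopologicalSpace A] (w x : ℕ → A) :
    Tendsto (fun k => splice k w x) atTop (𝓝 w) := by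
  rw [tendsto_pi_nhds]
  intro i
  refine tendsto_const_nhds.congr' ?_
  filter_upwards [eventually_gt_atTop i] with k hk
  exact (splice_of_lt w x hk).symm

variable [TopologicalSpace A] [DiscreteTopology A]

theorem isOpen_setOf_pref (p : List A → Prop) (k : ℕ) : IsOpen {w : ℕ → A | p (pref w k)} := by
  rw [isOpen_iff_mem_nhds]
  intro w hw
  refine mem_of_superset
    ((PiNat.isOpen_cylinder (fun _ => A) w k).mem_nhds (PiNat.self_mem_cylinder w k)) ?_
  intro w' hw'
  simpa only [Set.mem_ofPred_eq, pref_congr hw'] using hw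

/-- If every infinite word has a prefix satisfying `p`, the length of such a prefix can be
bounded uniformly. -/
theorem exists_uniform_prefix_bound [Finite A] (p : List A → Prop)
    (h : ∀ w : ℕ → A, ∃ k, p (pref w k)) : ∃ K, ∀ w : ℕ → A, ∃ k ≤ K, p (pref w k) := by
  obtain ⟨K, hK⟩ := isCompact_univ.elim_directed_cover
    (fun K : ℕ => ⋃ k ≤ K, {w : ℕ → A | p (pref w k)})
    (fun K => isOpen_biUnion fun k _ => isOpen_setOf_pref p k)
    (fun w _ => by
      obtain ⟨k, hk⟩ := h w
      exact Set.mem_iUnion.2 ⟨k, Set.mem_biUnion (show k ≤ k from le_rfl) hk⟩)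
    (directed_of_isDirected_le fun a b hab =>
      Set.biUnion_subset_biUnion_left fun k hk => le_trans hk hab)
  refine ⟨K, fun w => ?_⟩
  simpa using hK (Set.mem_univ w)

theorem tendstoUniformly_comp_splice [Finite A] {E : Type*} [UniformSpace E]
    {f : (ℕ → A) → E} (hf : Continuous f) (x : ℕ → A) :
    TendstoUniformly (fun k w => f (splice k w x)) f atTop := by
  let _ : MetricSpace (ℕ → A) := PiNat.metricSpace
  refine (CompactSpace.uniformContinuous_of_continuous hf).comp_tendstoUniformly
    (g := f) (F := fun k w => splice k w x) (f := id) ?_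
  rw [Metric.tendstoUniformly_iff]
  intro ε hε
  have hlim : Tendsto (fun k : ℕ => (1 / 2 : ℝ) ^ k) atTop (𝓝 0) :=
    tendsto_pow_atTop_nhds_zero_of_lt_one (by norm_num) (by norm_num)
  filter_upwards [hlim.eventually_lt_const hε] with k hk w
  refine lt_of_le_of_lt ?_ hk
  exact PiNat.mem_cylinder_iff_dist_le.1 fun i hi => (splice_of_lt w x hi).symm

end PrefixLemmas

section Products

variable {A R : Type*} [Finite A] [NormedRing R]

theorem exists_norm_prod_map_le (B : A → R) :
    ∃ b, 1 ≤ b ∧ ∀ v : List A, ‖(v.map B).prod‖ ≤ ‖(1 : R)‖ * b ^ v.length := by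
  obtain ⟨c, hc⟩ := (Set.finite_range fun a => ‖B a‖).bddAbove
  refine ⟨max 1 c, le_max_left _ _, fun v => ?_⟩
  induction v using List.reverseRecOn with
  | nil => simp
  | append_singleton v a ih =>
    have ha : ‖B a‖ ≤ max 1 c := (hc ⟨a, rfl⟩).trans (le_max_right _ _)
    have : ‖(v.map B).prod * B a‖ ≤ (‖(1 : R)‖ * max 1 c ^ v.length) * max 1 c :=
      (norm_mul_le _ _).trans (by gcongr)
    simpa [pow_succ, mul_assoc] using this

variable [TopologicalSpace A] [DiscreteTopology A]

/-- If all infinite products over a finite family vanish, they do so uniformly. -/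
theorem tendstoUniformly_prod_zero (B : A → R)
    (h : ∀ w : ℕ → A, Tendsto (fun k => ((pref w k).map B).prod) atTop (𝓝 0)) :
    TendstoUniformly (fun k (w : ℕ → A) => ((pref w k).map B).prod) 0 atTop := by
  obtain ⟨K, hK⟩ := exists_uniform_prefix_bound
    (fun v : List A => 0 < v.length ∧ ‖(v.map B).prod‖ ≤ 1 / 2) fun w => by
      have hsmall := (tendsto_zero_iff_norm_tendsto_zero.1 (h w)).eventually_le_const
        (show (0 : ℝ) < 1 / 2 by norm_num)
      obtain ⟨k, hk, hk'⟩ := (hsmall.and (eventually_gt_atTop 0)).exists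
      exact ⟨k, by simpa [pref] using hk', hk⟩
  obtain ⟨b, hb, hbound⟩ := exists_norm_prod_map_le B
  set S := ‖(1 : R)‖ * b ^ (K + 1) with hS
  have hS0 : 0 ≤ S := by positivity
  have key : ∀ m, ∀ w : ℕ → A, ‖((pref w m).map B).prod‖ ≤ S * (1 / 2) ^ (m / (K + 1)) := by
    intro m
    induction m using Nat.strong_induction_on with
    | _ m ih =>
      intro w
      rcases lt_or_ge m (K + 1) with hm | hm
      · rw [Nat.div_eq_of_lt hm, pow_zero, mul_one]
        refine (hbound _).trans ?_
        have : (pref w m).length ≤ K + 1 := by simpa [pref] using hm.le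
        rw [hS]
        gcongr
      · obtain ⟨k, hkK, hk, hk'⟩ := hK w
        have hk : 0 < k := by simpa [pref] using hk
        obtain ⟨j, rfl⟩ : ∃ j, m = k + j := ⟨m - k, by omega⟩
        have hdiv : (k + j) / (K + 1) ≤ j / (K + 1) + 1 := by
          rw [← Nat.add_div_right _ (Nat.succ_pos K)]
          exact Nat.div_le_div_right (by omega)
        rw [pref_add, List.map_append, List.prod_append]
        calc _ ≤ 1 / 2 * (S * (1 / 2) ^ (j / (K + 1))) :=
              (norm_mul_le _ _).trans
                (mul_le_mul hk' (ih j (by omega) _) (norm_nonneg _) (by norm_num))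
          _ = S * (1 / 2) ^ (j / (K + 1) + 1) := by ring
          _ ≤ S * (1 / 2) ^ ((k + j) / (K + 1)) :=
              mul_le_mul_of_nonneg_left
                (pow_le_pow_of_le_one (by norm_num) (by norm_num) hdiv) hS0
  have hlim : Tendsto (fun m : ℕ => S * (1 / 2 : ℝ) ^ (m / (K + 1))) atTop (𝓝 0) := by
    simpa using ((tendsto_pow_atTop_nhds_zero_of_lt_one (r := (1 / 2 : ℝ)) (by norm_num)
      (by norm_num)).comp (Nat.tendsto_div_const_atTop (Nat.succ_ne_zero K))).const_mul S
  rw [Metric.tendstoUniformly_iff]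
  intro ε hε
  filter_upwards [hlim.eventually_lt_const hε] with m hm w
  simpa using (key m w).trans_lt hm

/-- If all infinite products over a finite family converge, with a limit depending
continuously on the infinite word, then the convergence is uniform. -/
theorem tendstoUniformly_prod_of_continuous [Nonempty A] (B : A → R) {L : (ℕ → A) → R}
    (hL : Continuous L)
    (h : ∀ w : ℕ → A, Tendsto (fun k => ((pref w k).map B).prod) atTop (𝓝 (L w))) :
    TendstoUniformly (fun k (w : ℕ → A) => ((pref w k).map B).prod) L atTop := by
  have hsplice : ∀ k w x, L (splice k w x) = ((pref w k).map B).prod * L x := by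
    intro k w x
    refine tendsto_nhds_unique ((h (splice k w x)).comp (tendsto_add_atTop_nat k)) ?_
    refine ((h x).const_mul _).congr fun j => ?_
    simp [add_comm j k, pref_splice_add]
  have hmul : ∀ w x, L w * L x = L w := by
    intro w x
    refine tendsto_nhds_unique ((h w).mul_const (L x)) ?_
    simpa only [Function.comp_def, hsplice] using (hL.tendsto w).comp (tendsto_splice w x)
  have hconst : ∀ b, L (fun _ => b) * B b = L fun _ => b := by
    intro b
    refine tendsto_nhds_unique ((h fun _ => b).mul_const (B b)) ?_
    refine ((h fun _ => b).comp (tendsto_add_atTop_nat 1)).congr fun k => ?_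
    simp [pref_succ]
  have hletter : ∀ w b, L w * B b = L w := by
    intro w b
    rw [← hmul w fun _ => b, mul_assoc, hconst]
  obtain ⟨a⟩ := ‹Nonempty A›
  set P := L fun _ => a with hP
  have hPP : P * (1 - P) = 0 := by rw [mul_sub, mul_one, hmul, sub_self]
  have hfix : ∀ v : List A,
      (1 - P) * ((v.map B).prod * (1 - P)) = (v.map B).prod * (1 - P) := by
    have hword : ∀ v : List A, P * (v.map B).prod = P := by
      intro v
      induction v with
      | nil => simp
      | cons b v ih => rw [List.map_cons, List.prod_cons, ← mul_assoc, hletter, ih]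
    intro v
    rw [sub_mul, one_mul, ← mul_assoc, hword, hPP, sub_zero]
  have hprod : ∀ v : List A,
      (v.map fun b => B b * (1 - P)).prod * (1 - P) = (v.map B).prod * (1 - P) := by
    intro v
    induction v with
    | nil => simp
    | cons b v ih =>
      simp only [List.map_cons, List.prod_cons, mul_assoc, ih, hfix]
  have hprod' : ∀ w : ℕ → A, ∀ k > 0, ((pref w k).map fun b => B b * (1 - P)).prod =
      ((pref w k).map B).prod * (1 - P) := by
    intro w k hk
    obtain ⟨k, rfl⟩ : ∃ j, k = j + 1 := ⟨k - 1, by omega⟩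
    have hidem : (1 - P) * (1 - P) = 1 - P := by rw [sub_mul, one_mul, hPP, sub_zero]
    rw [← hprod]
    simp only [pref_succ, List.map_append, List.prod_append, List.map_singleton,
      List.prod_singleton, mul_assoc, hidem]
  have hzero := tendstoUniformly_prod_zero (fun b => B b * (1 - P)) fun w => by
    have hlim := (h w).mul_const (1 - P)
    rw [mul_sub, mul_one, hmul, sub_self] at hlim
    refine hlim.congr' ?_
    filter_upwards [eventually_gt_atTop 0] with k hk
    exact (hprod' w k hk).symm
  have hsum := hzero.add (tendstoUniformly_comp_splice hL fun _ => a)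
  rw [zero_add] at hsum
  intro u hu
  filter_upwards [hsum u hu, eventually_gt_atTop 0] with k hsum_k hk w
  have heq : ((pref w k).map fun b => B b * (1 - P)).prod + L (splice k w fun _ => a) =
      ((pref w k).map B).prod := by
    rw [hprod' w k hk, hsplice, ← hP, mul_sub, mul_one, sub_add_cancel]
  rw [← heq]
  exact hsum_k w

end Products

theorem continuous_dotProduct_mulVec {n : ℕ} (I F : Fin n → ℝ) :
    Continuous fun X : Matrix (Fin n) (Fin n) ℝ => I ⬝ᵥ X *ᵥ F := by
  fun_prop

open scoped Matrix.Norms.Operator in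
/-- Over a continuous RCP set, the word function of a WFA converges uniformly. -/
theorem tendstoUniformly_wfaWord {A : Type*} [Finite A] [Nonempty A] [TopologicalSpace A]
    [DiscreteTopology A] {n : ℕ} (I F : Fin n → ℝ) (M : A → Matrix (Fin n) (Fin n) ℝ)
    {L : (ℕ → A) → Matrix (Fin n) (Fin n) ℝ} (hL : Continuous L)
    (h : ∀ w : ℕ → A, Tendsto (fun k => wordProd M (pref w k)) atTop (𝓝 (L w))) :
    TendstoUniformly (fun k (w : ℕ → A) => wfaWord I M F (pref w k))
      (fun w => I ⬝ᵥ L w *ᵥ F) atTop := by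
  let φ : Matrix (Fin n) (Fin n) ℝ →ₗ[ℝ] ℝ :=
    { toFun := fun X => I ⬝ᵥ X *ᵥ F
      map_add' := fun X Y => by rw [add_mulVec, dotProduct_add]
      map_smul' := fun c X => by rw [smul_mulVec, dotProduct_smul, RingHom.id_apply] }
  exact (LinearMap.toContinuousLinearMap φ).uniformContinuous.comp_tendstoUniformly
    (tendstoUniformly_prod_of_continuous M hL h)

/-- Let `𝒜 = (I, (A_a), F)` be a WFA with transition matrix set `B = {A_a}`.  Then:
(1) if `B` is an RCP set, then `f_𝒜` is defined everywhere;
(2) if `B` is a continuous RCP set, then `𝒜` is uniformly convergent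
    (and hence `f_𝒜` is continuous on `Σ^ω`). -/
theorem rcp_transition_matrices
    {A : Type*} [Fintype A] [Nonempty A] [TopologicalSpace A] [DiscreteTopology A]
    {n : ℕ} (I : Fin n → ℝ) (M : A → Matrix (Fin n) (Fin n) ℝ) (F : Fin n → ℝ) :
    (IsRCP M → ∀ w : ℕ → A, ∃ c : ℝ,
        Tendsto (fun k => wfaWord I M F (pref w k)) atTop (𝓝 c)) ∧
    (IsContRCP M → ∃ f : (ℕ → A) → ℝ,
        UnifConv (wfaWord I M F) f ∧ Continuous f) := by
  have hcont := continuous_dotProduct_mulVec I F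
  refine ⟨fun h w => ?_, ?_⟩
  · obtain ⟨L, hL⟩ := h w
    exact ⟨_, (hcont.tendsto L).comp hL⟩
  · rintro ⟨L, hL, h⟩
    refine ⟨fun w => I ⬝ᵥ L w *ᵥ F, ⟨fun w => (hcont.tendsto (L w)).comp (h w), ?_⟩,
      hcont.comp hL⟩
    intro ε hε
    obtain ⟨k₀, hk₀⟩ := eventually_atTop.1
      (Metric.tendstoUniformly_iff.1 (tendstoUniformly_wfaWord I F M hL h) ε hε)
    refine ⟨k₀, fun w k hk => ?_⟩
    rw [← Real.dist_eq, dist_comm]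
    exact hk₀ k hk.le w
end

section
/- Let Σ = {0,1} and let f be a real-valued function defined at least on Ω, with corresponding real function f̂ : [0,1) → ℝ given by f̂(x) = f(bin(x)). Then f̂ is uniformly continuous on [0,1) if and only if both of the following hold: (1) the restriction of f to Ω is uniformly continuous (with respect to the Cantor metric), and (2) the unique continuous function g : Σ^ω → ℝ agreeing with f on Ω satisfies g(v10^ω) = g(v01^ω) for every finite word v ∈ Σ*. -/
open Filter Topology

/-- Concatenation of a finite word `u` with an infinite word `w`. -/
def wcat {A : Type*} (u : List A) (w : ℕ → A) : ℕ → A :=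
  fun i => if h : i < u.length then u[i] else w (i - u.length)

/-- The real number in `[0, 1)` with binary expansion `0.w₁w₂w₃…` (digit `i` is `w i`,
`true` standing for the digit 1). -/
noncomputable def num (w : ℕ → Bool) : ℝ :=
  ∑' i : ℕ, if w i then ((1 : ℝ) / 2) ^ (i + 1) else 0

/-- The set `Ω` of infinite binary words that do not end in `1^ω`. -/
def Omega : Set (ℕ → Bool) := {w | ¬ ∃ k : ℕ, ∀ i ≥ k, w i = true}

theorem wcat_nil {A : Type*} (w : ℕ → A) : wcat [] w = w := by
  funext i; simp [wcat]

theorem wcat_cons_zero {A : Type*} (a : A) (v : List A) (w : ℕ → A) :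
    wcat (a :: v) w 0 = a := by
  simp [wcat]

theorem wcat_cons_succ {A : Type*} (a : A) (v : List A) (w : ℕ → A) (i : ℕ) :
    wcat (a :: v) w (i + 1) = wcat v w i := by
  simp [wcat]

theorem wcat_append {A : Type*} (u v : List A) (w : ℕ → A) :
    wcat (u ++ v) w = wcat u (wcat v w) := by
  induction u with
  | nil => simp [wcat_nil]
  | cons a u ih =>
    funext i
    cases i with
    | zero => simp [wcat_cons_zero]
    | succ i => simp only [List.cons_append, wcat_cons_succ, ih]

theorem wcat_apply_of_length_le {A : Type*} (v : List A) (w : ℕ → A) {i : ℕ}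
    (hi : v.length ≤ i) : wcat v w i = w (i - v.length) := by
  simp [wcat, not_lt.mpr hi]

/-- The first `n` letters of an infinite word. -/
def wtake {A : Type*} (w : ℕ → A) (n : ℕ) : List A := (List.range n).map w

theorem wcat_wtake_apply {A : Type*} (w x : ℕ → A) {n i : ℕ} (hi : i < n) :
    wcat (wtake w n) x i = w i := by
  simp [wcat, wtake, hi]

theorem wcat_wtake_shift {A : Type*} (w : ℕ → A) (n : ℕ) :
    wcat (wtake w n) (fun i => w (n + i)) = w := by
  funext i
  by_cases hi : i < n
  · exact wcat_wtake_apply w _ hi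
  · rw [wcat_apply_of_length_le _ _ (by simpa [wtake] using hi)]
    simp only [wtake, List.length_map, List.length_range]
    congr 1
    omega

theorem tendsto_wcat_wtake {A : Type*} [TopologicalSpace A] (w x : ℕ → A) :
    Tendsto (fun n => wcat (wtake w n) x) atTop (𝓝 w) := by
  rw [tendsto_pi_nhds]
  intro i
  refine tendsto_const_nhds.congr' ?_
  filter_upwards [eventually_gt_atTop i] with n hn
  exact (wcat_wtake_apply w x hn).symm

theorem wcat_false_mem_Omega (v : List Bool) : wcat v (fun _ => false) ∈ Omega := by
  rintro ⟨k, hk⟩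
  have h := hk (v.length + k) (by omega)
  rw [wcat_apply_of_length_le _ _ (by omega)] at h
  exact Bool.false_ne_true h

theorem dense_Omega : Dense Omega := fun w =>
  mem_closure_of_tendsto (tendsto_wcat_wtake w fun _ => false)
    (Eventually.of_forall fun _ => wcat_false_mem_Omega _)

theorem eq_true_or_eq_wcat_of_notMem_Omega {w : ℕ → Bool} (hw : w ∉ Omega) :
    w = (fun _ => true) ∨ ∃ v, w = wcat (v ++ [false]) (fun _ => true) := by
  classical
  have h : ∃ k : ℕ, ∀ i ≥ k, w i = true := by simpa [Omega] using hw
  have hspec := Nat.find_spec h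
  rcases hn : Nat.find h with _ | n
  · left
    funext i
    exact hspec i (by omega)
  · right
    rw [hn] at hspec
    have hwn : w n = false := by
      by_contra hne
      refine Nat.find_min h (m := n) (by omega) fun i hi => ?_
      rcases hi.eq_or_lt with rfl | hi
      · simpa using hne
      · exact hspec i hi
    refine ⟨wtake w n, ?_⟩
    have hpre : wtake w n ++ [false] = wtake w (n + 1) := by
      simp [wtake, List.range_succ, hwn]
    rw [hpre]
    conv_lhs => rw [← wcat_wtake_shift w (n + 1)]
    congr 1
    funext i
    exact hspec _ (by omega)

theorem norm_num_term_le (w : ℕ → Bool) (i : ℕ) :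
    ‖(if w i then ((1 : ℝ) / 2) ^ (i + 1) else 0)‖ ≤ ((1 : ℝ) / 2) ^ (i + 1) := by
  split_ifs
  · rw [Real.norm_of_nonneg (by positivity)]
  · rw [norm_zero]; positivity

theorem summable_half_pow_succ : Summable fun i : ℕ => ((1 : ℝ) / 2) ^ (i + 1) :=
  (summable_nat_add_iff 1).mpr summable_geometric_two

theorem summable_num (w : ℕ → Bool) :
    Summable fun i : ℕ => if w i then ((1 : ℝ) / 2) ^ (i + 1) else 0 :=
  Summable.of_norm_bounded summable_half_pow_succ (norm_num_term_le w)

theorem continuous_num : Continuous num := by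
  refine continuous_tsum (fun i => ?_) summable_half_pow_succ fun i w => norm_num_term_le w i
  exact (continuous_of_discreteTopology
    (f := fun b : Bool => if b then ((1 : ℝ) / 2) ^ (i + 1) else 0)).comp (continuous_apply i)

theorem num_nonneg (w : ℕ → Bool) : 0 ≤ num w :=
  tsum_nonneg fun i => by split_ifs <;> positivity

theorem num_false : num (fun _ => false) = 0 := by simp [num]

theorem num_true : num (fun _ => true) = 1 := by
  have h := summable_geometric_two.sum_add_tsum_nat_add 1
  rw [tsum_geometric_two] at h
  simp only [num, if_true]
  norm_num at h ⊢
  linarith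

theorem num_add_num_not (w : ℕ → Bool) : num w + num (fun i => !w i) = 1 := by
  rw [← num_true, num, num, ← (summable_num w).tsum_add (summable_num _), num]
  refine tsum_congr fun i => ?_
  cases w i <;> simp

theorem num_le_one (w : ℕ → Bool) : num w ≤ 1 := by
  linarith [num_add_num_not w, num_nonneg fun i => !w i]

theorem eq_false_of_num_eq_zero {w : ℕ → Bool} (h : num w = 0) : w = fun _ => false := by
  funext i
  by_contra hi
  have hi' : w i = true := by simpa using hi
  have hle := (summable_num w).le_tsum i fun j _ => by split_ifs <;> positivity
  have hpos : (0 : ℝ) < (1 / 2) ^ (i + 1) := by positivity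
  rw [num] at h
  rw [h, if_pos hi'] at hle
  linarith

theorem eq_true_of_num_eq_one {w : ℕ → Bool} (h : num w = 1) : w = fun _ => true := by
  have h0 := eq_false_of_num_eq_zero (w := fun i => !w i) (by linarith [num_add_num_not w])
  funext i
  simpa using congrFun h0 i

theorem num_wcat_cons (a : Bool) (v : List Bool) (w : ℕ → Bool) :
    num (wcat (a :: v) w) = ((if a then 1 else 0) + num (wcat v w)) / 2 := by
  rw [num, (summable_num _).tsum_eq_zero_add]
  simp only [wcat_cons_zero, wcat_cons_succ]
  have h : ∀ i : ℕ, (if wcat v w i then ((1 : ℝ) / 2) ^ (i + 1 + 1) else 0) =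
      (if wcat v w i then ((1 : ℝ) / 2) ^ (i + 1) else 0) * (1 / 2) := fun i => by
    split_ifs
    · rw [pow_succ _ (i + 1)]
    · simp
  rw [tsum_congr h, tsum_mul_right, num]
  cases a <;> simp <;> ring

theorem num_wcat_inj (v : List Bool) {x y : ℕ → Bool} :
    num (wcat v x) = num (wcat v y) ↔ num x = num y := by
  induction v with
  | nil => simp [wcat_nil]
  | cons a v ih => rw [num_wcat_cons, num_wcat_cons, ← ih, div_left_inj' two_ne_zero, add_right_inj]

theorem num_wcat_true_false_eq (v : List Bool) :
    num (wcat (v ++ [true]) fun _ => false) = num (wcat (v ++ [false]) fun _ => true) := by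
  rw [wcat_append, wcat_append, num_wcat_inj]
  simp [num_wcat_cons, wcat_nil, num_true, num_false]

/-- Two words with the same value that first differ at a known place are `v10^ω` and `v01^ω`. -/
theorem eq_wcat_of_num_wcat_eq {v : List Bool} {s t : ℕ → Bool}
    (h : num (wcat (v ++ [true]) s) = num (wcat (v ++ [false]) t)) :
    s = (fun _ => false) ∧ t = fun _ => true := by
  rw [wcat_append, wcat_append, num_wcat_inj] at h
  simp only [num_wcat_cons, wcat_nil, if_true, Bool.false_eq_true, if_false] at h
  have hs := num_nonneg s
  have ht := num_le_one t
  exact ⟨eq_false_of_num_eq_zero (by linarith), eq_true_of_num_eq_one (by linarith)⟩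

theorem exists_wcat_of_ne {u w : ℕ → Bool} (h : u ≠ w) :
    ∃ (v : List Bool) (a : Bool) (s t : ℕ → Bool),
      u = wcat (v ++ [a]) s ∧ w = wcat (v ++ [!a]) t := by
  classical
  have hex : ∃ n, u n ≠ w n := Function.ne_iff.mp h
  obtain ⟨n, hn, hmin⟩ : ∃ n, u n ≠ w n ∧ ∀ m < n, u m = w m :=
    ⟨Nat.find hex, Nat.find_spec hex, fun m hm => by simpa using Nat.find_min hex hm⟩
  have hu : wtake u n ++ [u n] = wtake u (n + 1) := by simp [wtake, List.range_succ]
  have hw : wtake u n ++ [!u n] = wtake w (n + 1) := by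
    have hwn : w n = !u n := by revert hn; cases u n <;> cases w n <;> simp
    rw [← hwn]
    simpa [wtake, List.range_succ] using hmin
  exact ⟨wtake u n, u n, fun i => u (n + 1 + i), fun i => w (n + 1 + i),
    by rw [hu, wcat_wtake_shift], by rw [hw, wcat_wtake_shift]⟩

/-- A function identifying `v10^ω` with `v01^ω` for every `v` factors through `num`. -/
theorem eq_of_num_eq {X : Type*} {g : (ℕ → Bool) → X}
    (hg : ∀ v : List Bool,
      g (wcat (v ++ [true]) fun _ => false) = g (wcat (v ++ [false]) fun _ => true))
    {u w : ℕ → Bool} (h : num u = num w) : g u = g w := by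
  by_cases huw : u = w
  · rw [huw]
  obtain ⟨v, a, s, t, rfl, rfl⟩ := exists_wcat_of_ne huw
  cases a with
  | true =>
    obtain ⟨rfl, rfl⟩ := eq_wcat_of_num_wcat_eq h
    exact hg v
  | false =>
    obtain ⟨rfl, rfl⟩ := eq_wcat_of_num_wcat_eq h.symm
    exact (hg v).symm

theorem surjOn_num : Set.SurjOn num Set.univ (Set.Icc 0 1) := by
  intro x hx
  obtain ⟨d, -, rfl⟩ := Real.ofDigits_SurjOn one_lt_two hx
  refine ⟨fun i => decide (d i = 1), Set.mem_univ _, tsum_congr fun i => ?_⟩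
  rcases (show d i = 0 ∨ d i = 1 by omega) with h | h <;> simp [Real.ofDigitsTerm, h]

theorem num_mem_Ico {w : ℕ → Bool} (hw : w ∈ Omega) : num w ∈ Set.Ico (0 : ℝ) 1 := by
  refine ⟨num_nonneg w, lt_of_le_of_ne (num_le_one w) fun h => hw ⟨0, fun i _ => ?_⟩⟩
  rw [eq_true_of_num_eq_one h]

theorem surjOn_num_Omega : Set.SurjOn num Omega (Set.Ico 0 1) := by
  intro x hx
  obtain ⟨w, -, rfl⟩ := surjOn_num (Set.Ico_subset_Icc_self hx)
  by_cases hw : w ∈ Omega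
  · exact ⟨w, hw, rfl⟩
  rcases eq_true_or_eq_wcat_of_notMem_Omega hw with rfl | ⟨v, rfl⟩
  · exact absurd num_true hx.2.ne
  · exact ⟨_, wcat_false_mem_Omega _, num_wcat_true_false_eq v⟩

/-- A continuous function on infinite words that factors through `num` induces a uniformly
continuous function on `[0, 1]`. -/
theorem uniformContinuousOn_of_comp_num {g : (ℕ → Bool) → ℝ} {F : ℝ → ℝ} (hg : Continuous g)
    (hF : ∀ w, F (num w) = g w) : UniformContinuousOn F (Set.Icc 0 1) := by
  refine isCompact_Icc.uniformContinuousOn_of_continuous ?_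
  rw [continuousOn_iff_continuous_domRestrict]
  let p : (ℕ → Bool) → Set.Icc (0 : ℝ) 1 := fun w => ⟨num w, num_nonneg w, num_le_one w⟩
  have hp : Continuous p := continuous_num.subtype_mk _
  have hsurj : Function.Surjective p := fun x => by
    obtain ⟨w, -, hw⟩ := surjOn_num x.2
    exact ⟨w, Subtype.ext hw⟩
  rw [(hp.isClosedMap.isQuotientMap hp hsurj).continuous_iff]
  exact hg.congr fun w => (hF w).symm

theorem exists_continuous_eqOn_Omega {f : (ℕ → Bool) → ℝ} (hf : UniformContinuousOn f Omega) :
    ∃ g : (ℕ → Bool) → ℝ, Continuous g ∧ ∀ u ∈ Omega, g u = f u := by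
  have hf' := uniformContinuousOn_iff_restrict.mp hf
  exact ⟨dense_Omega.extend (Omega.domRestrict f),
    (dense_Omega.uniformContinuous_extend hf').continuous,
    fun u hu => dense_Omega.extend_of_ind hf' ⟨u, hu⟩⟩

/-- Let `f` be a real-valued function on binary words (relevant only on `Ω`), with
corresponding real function `f̂ : [0,1) → ℝ`, `f̂(x) = f(bin x)`.  Then `f̂` is uniformly
continuous on `[0,1)` iff (1) `f` is uniformly continuous on `Ω`, and (2) the (unique)
continuous `g : Σ^ω → ℝ` agreeing with `f` on `Ω` satisfies `g(v10^ω) = g(v01^ω)` for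
every finite word `v`. -/
theorem real_uniform_continuity_characterization
    (f : (ℕ → Bool) → ℝ) (fhat : ℝ → ℝ)
    (hfhat : ∀ u ∈ Omega, fhat (num u) = f u) :
    UniformContinuousOn fhat (Set.Ico 0 1) ↔
      (UniformContinuousOn f Omega ∧
        ∀ g : (ℕ → Bool) → ℝ, Continuous g → (∀ u ∈ Omega, g u = f u) →
          ∀ v : List Bool,
            g (wcat (v ++ [true]) (fun _ => false)) =
              g (wcat (v ++ [false]) (fun _ => true))) := by
  constructor
  · intro hF
    constructor
    · have hnum : UniformContinuousOn num Omega :=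
        (CompactSpace.uniformContinuous_of_continuous continuous_num).uniformContinuousOn
      exact (hF.comp hnum fun u hu => num_mem_Ico hu).congr hfhat
    · intro g hg hgf v
      set u := wcat (v ++ [true]) fun _ => false with hu
      set w := wcat (v ++ [false]) fun _ => true with hw
      have hnum : num u = num w := num_wcat_true_false_eq v
      have huΩ : u ∈ Omega := wcat_false_mem_Omega _
      let z : ℕ → ℕ → Bool := fun n => wcat (wtake w n) fun _ => false
      have hzΩ : ∀ n, z n ∈ Omega := fun n => wcat_false_mem_Omega _
      have hz : Tendsto z atTop (𝓝 w) := tendsto_wcat_wtake w _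
      have hzw : Tendsto (fun n => g (z n)) atTop (𝓝 (g w)) := (hg.tendsto w).comp hz
      have hzu : Tendsto (fun n => g (z n)) atTop (𝓝 (g u)) := by
        have hnz : Tendsto (fun n => num (z n)) atTop (𝓝[Set.Ico 0 1] (num u)) :=
          tendsto_nhdsWithin_iff.mpr ⟨hnum ▸ (continuous_num.tendsto w).comp hz,
            Eventually.of_forall fun n => num_mem_Ico (hzΩ n)⟩
        have h := (hF.continuousOn _ (num_mem_Ico huΩ)).tendsto.comp hnz
        rw [hfhat u huΩ, ← hgf u huΩ] at h
        exact h.congr fun n => by rw [Function.comp_apply, hfhat _ (hzΩ n), hgf _ (hzΩ n)]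
      exact tendsto_nhds_unique hzu hzw
  · rintro ⟨hf, hg⟩
    obtain ⟨g, hgc, hgf⟩ := exists_continuous_eqOn_Omega hf
    have hfac : Function.FactorsThrough g num := fun _ _ h => eq_of_num_eq (hg g hgc hgf) h
    have hG := uniformContinuousOn_of_comp_num hgc (F := Function.extend num g 0)
      fun w => hfac.extend_apply 0 w
    refine (hG.mono Set.Ico_subset_Icc_self).congr fun x hx => ?_
    obtain ⟨u, hu, rfl⟩ := surjOn_num_Omega hx
    rw [hfac.extend_apply, hfhat u hu, hgf u hu]
end
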